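/- Let $c > 1$ and let $a : \mathbb{N} \to \mathbb{N}$ satisfy $a(n+1) > c \cdot a(n)$ for all $n$. Fix $k \ge 2$ and $f \in C_c^\infty(\mathbb{R}^{k-1})$. Define $F_N(y) = \sum_{m \in \mathbb{Z}^{k-1}} f(N(m+y))$ and the $k$-level correlation sum $R_k(f,N)(\alpha) = \frac{1}{N} \sum^*_{x_i \le N} F_N(\alpha \Delta(x))$, where $\Delta(x) = (a(x_1)-a(x_2), \dots, a(x_{k-1})-a(x_k))$ and $\sum^*$ runs over $k$-tuples of distinct integers in $[1,N]$. Then for every $\epsilon > 0$, $\int_0^1 R_k(f,N)(\alpha)\, d\alpha = \hat f(0) + O_{f,\epsilon}(N^{-1+\epsilon})$, where $\hat f(0) = \int_{\mathbb{R}^{k-1}} f(x)\, dx$. -/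

import Mathlib

open MeasureTheory

/-- The `k`-level correlation sum `R_k(f,N)(α)`. -/
noncomputable def Rk (a : ℕ → ℕ) (k : ℕ) (f : (Fin (k - 1) → ℝ) → ℝ) (N : ℕ) (α : ℝ) : ℝ :=
  (1 / (N : ℝ)) *
    ∑ x ∈ (Fintype.piFinset fun _ : Fin k => Finset.Icc 1 N).filter Function.Injective,
      ∑' m : Fin (k - 1) → ℤ,
        f fun i => (N : ℝ) * ((m i : ℝ) + α *
          ((a (x ⟨i.1, by have := i.2; omega⟩) : ℝ) -
           (a (x ⟨i.1 + 1, by have := i.2; omega⟩) : ℝ)))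

/-- The additive character `y ↦ exp (-2πi n·y)` on `ℝ^d`. -/
noncomputable def negChar {d : ℕ} (n : Fin d → ℤ) (y : Fin d → ℝ) : ℂ :=
  Complex.exp (-(2 * Real.pi * Complex.I * ∑ i, (n i : ℂ) * y i))

lemma mFourier_coe {d : ℕ} (n : Fin d → ℤ) (y : Fin d → ℝ) :
    UnitAddTorus.mFourier n (fun i => (y i : UnitAddCircle)) =
      Complex.exp (2 * Real.pi * Complex.I * ∑ i, (n i : ℂ) * y i) := by
  simp only [UnitAddTorus.mFourier, ContinuousMap.coe_mk, fourier_coe_apply]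
  rw [← Complex.exp_sum, Finset.mul_sum]
  congr 1
  refine Finset.sum_congr rfl fun i _ => ?_
  simp
  ring

lemma mFourier_neg_coe {d : ℕ} (n : Fin d → ℤ) (y : Fin d → ℝ) :
    UnitAddTorus.mFourier (-n) (fun i => (y i : UnitAddCircle)) = negChar n y := by
  rw [mFourier_coe, negChar]
  simp

lemma continuous_tsum_shift {d : ℕ} {g : (Fin d → ℝ) → ℂ} (hg : Continuous g)
    (hsupp : ∀ y, g y ≠ 0 → ∀ i, |y i| < 1 / 2) :
    Continuous fun y : Fin d → ℝ => ∑' m : Fin d → ℤ, g fun i => (m i : ℝ) + y i := by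
  have hlf : LocallyFinite fun m : Fin d → ℤ =>
      Function.support fun y : Fin d → ℝ => g fun i => (m i : ℝ) + y i := by
    intro y₀
    refine ⟨Metric.ball y₀ 1, Metric.ball_mem_nhds _ one_pos, ?_⟩
    refine (Set.finite_Icc (fun i => ⌊-y₀ i - 2⌋) (fun i => ⌈-y₀ i + 2⌉)).subset ?_
    rintro m ⟨y, hy, hyb⟩
    have hd : ∀ i, |y i - y₀ i| < 1 := fun i => by
      have := (dist_pi_lt_iff one_pos).1 (Metric.mem_ball.1 hyb) i
      rwa [Real.dist_eq] at this
    refine ⟨fun i => ?_, fun i => ?_⟩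
    · have h1 := abs_lt.1 (hsupp _ hy i)
      have h2 := abs_lt.1 (hd i)
      have : (⌊-y₀ i - 2⌋ : ℝ) ≤ m i := (Int.floor_le _).trans (by linarith)
      exact_mod_cast this
    · have h1 := abs_lt.1 (hsupp _ hy i)
      have h2 := abs_lt.1 (hd i)
      have : (m i : ℝ) ≤ ⌈-y₀ i + 2⌉ := le_trans (by linarith) (Int.le_ceil _)
      exact_mod_cast this
  have heq : (fun y : Fin d → ℝ => ∑' m : Fin d → ℤ, g fun i => (m i : ℝ) + y i) =
      fun y => ∑ᶠ m : Fin d → ℤ, g fun i => (m i : ℝ) + y i := by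
    funext y
    exact tsum_eq_finsum ((hlf.point_finite y).subset fun m hm => hm)
  rw [heq]
  exact continuous_finsum (fun m => hg.comp (by fun_prop)) hlf

lemma exists_periodization {d : ℕ} {g : (Fin d → ℝ) → ℂ} (hg : Continuous g)
    (hsupp : ∀ y, g y ≠ 0 → ∀ i, |y i| < 1 / 2) :
    ∃ F : C(UnitAddTorus (Fin d), ℂ), ∀ y : Fin d → ℝ,
      F (fun i => (y i : UnitAddCircle)) = ∑' m : Fin d → ℤ, g fun i => (m i : ℝ) + y i := by
  have hq : IsOpenQuotientMap
      (Pi.map fun _ : Fin d => ((↑) : ℝ → UnitAddCircle)) :=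
    IsOpenQuotientMap.piMap fun _ => QuotientAddGroup.isOpenQuotientMap_mk
  let π : C(Fin d → ℝ, UnitAddTorus (Fin d)) := ⟨_, hq.continuous⟩
  have hπ : Topology.IsQuotientMap π := hq.isQuotientMap
  let P : C(Fin d → ℝ, ℂ) := ⟨_, continuous_tsum_shift hg hsupp⟩
  have hfac : Function.FactorsThrough P π := by
    intro y z hyz
    have : ∀ i, ∃ q : ℤ, y i = z i + q := fun i => by
      have h : (y i : UnitAddCircle) = z i := congrFun hyz i
      have h0 : ((y i - z i : ℝ) : UnitAddCircle) = 0 := by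
        rw [AddCircle.coe_sub, h, sub_self]
      obtain ⟨q, hq⟩ := (AddCircle.coe_eq_zero_iff 1).1 h0
      refine ⟨q, ?_⟩
      simp only [zsmul_eq_mul, mul_one] at hq
      linarith
    choose q hq using this
    simp only [P, ContinuousMap.coe_mk]
    rw [← (Equiv.subRight q).tsum_eq]
    refine tsum_congr fun m => ?_
    congr 1
    funext i
    simp [hq]
  exact ⟨hπ.lift P hfac, fun y => DFunLike.congr_fun (hπ.lift_comp P hfac) y⟩

lemma mFourierCoeff_periodization {d : ℕ} {g : (Fin d → ℝ) → ℂ}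
    (hsupp : ∀ y, g y ≠ 0 → ∀ i, |y i| < 1 / 2) {F : UnitAddTorus (Fin d) → ℂ}
    (hF : ∀ y : Fin d → ℝ,
      F (fun i => (y i : UnitAddCircle)) = ∑' m : Fin d → ℤ, g fun i => (m i : ℝ) + y i)
    (n : Fin d → ℤ) :
    UnitAddTorus.mFourierCoeff F n = ∫ y, negChar n y * g y := by
  rw [UnitAddTorus.mFourierCoeff_eq_integral F n fun _ => -(1 / 2)]
  rw [← setIntegral_eq_integral_of_forall_compl_eq_zero (f := fun y => negChar n y * g y)
    (s := {x : Fin d → ℝ | ∀ i, x i ∈ Set.Ioc (-(1 / 2) : ℝ) (-(1 / 2) + 1)})]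
  · refine setIntegral_congr_fun
      (MeasurableSet.univ_pi' fun i => measurableSet_Ioc (α := ℝ)) fun y hy => ?_
    simp only [smul_eq_mul, mFourier_neg_coe, hF]
    congr 1
    rw [tsum_eq_single 0]
    · simp
    · intro m hm
      by_contra h
      apply hm
      funext i
      have h1 := abs_lt.1 (hsupp _ h i)
      have h2 := hy i
      simp only [Set.mem_Ioc] at h2
      have h3 : ((-1 : ℤ) : ℝ) < m i := by push_cast; linarith
      have h4 : (m i : ℝ) < (1 : ℤ) := by push_cast; linarith
      have h5 : -1 < m i := by exact_mod_cast h3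
      have h6 : m i < 1 := by exact_mod_cast h4
      show m i = 0
      omega
  · intro y hy
    by_contra h
    apply hy
    intro i
    have := abs_lt.1 (hsupp y (right_ne_zero_of_mul h) i)
    constructor <;> linarith

lemma integral_exp_two_pi_int (q : ℤ) :
    ∫ t in (0 : ℝ)..1, Complex.exp (2 * Real.pi * Complex.I * q * t) = if q = 0 then 1 else 0 := by
  split_ifs with h
  · simp [h]
  · have hc : (2 * Real.pi * Complex.I * q : ℂ) ≠ 0 := by
      simp [h, Real.pi_ne_zero]
    rw [integral_exp_mul_complex hc]
    have : Complex.exp (2 * Real.pi * Complex.I * q) = 1 := by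
      rw [mul_comm]; exact Complex.exp_int_mul_two_pi_mul_I q
    simp [this]

lemma hasSum_integral_periodization {d : ℕ} {g : (Fin d → ℝ) → ℂ} (hg : Continuous g)
    (hsupp : ∀ y, g y ≠ 0 → ∀ i, |y i| < 1 / 2)
    (hsum : Summable fun n : Fin d → ℤ => ∫ y, negChar n y * g y) (v : Fin d → ℤ) :
    HasSum (fun n : Fin d → ℤ => if ∑ i, n i * v i = 0 then ∫ y, negChar n y * g y else 0)
      (∫ t in (0 : ℝ)..1, ∑' m : Fin d → ℤ, g fun i => (m i : ℝ) + t * v i) := by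
  obtain ⟨F, hF⟩ := exists_periodization hg hsupp
  have hc := mFourierCoeff_periodization hsupp hF
  have hsum' : Summable (UnitAddTorus.mFourierCoeff F) := hsum.congr fun n => (hc n).symm
  let e : (Fin d → ℤ) → C(ℝ, ℂ) := fun n =>
    ⟨fun t => (∫ y, negChar n y * g y) *
      Complex.exp (2 * Real.pi * Complex.I * (∑ i, n i * v i : ℤ) * t), by fun_prop⟩
  have hpt : ∀ t : ℝ, ∑' m : Fin d → ℤ, g (fun i => (m i : ℝ) + t * v i) = ∑' n, e n t := by
    intro t
    rw [← hF fun i => t * v i,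
      ← (UnitAddTorus.hasSum_mFourier_series_apply_of_summable hsum' _).tsum_eq]
    refine tsum_congr fun n => ?_
    rw [hc, mFourier_coe, smul_eq_mul]
    simp only [e, ContinuousMap.coe_mk]
    congr 2
    push_cast
    rw [Finset.mul_sum, Finset.mul_sum, Finset.sum_mul]
    exact Finset.sum_congr rfl fun i _ => by ring
  simp only [hpt]
  have hint : ∀ n, ∫ t in (0 : ℝ)..1, e n t =
      if ∑ i, n i * v i = 0 then ∫ y, negChar n y * g y else 0 := by
    intro n
    simp only [e, ContinuousMap.coe_mk]
    rw [intervalIntegral.integral_const_mul, integral_exp_two_pi_int]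
    simp
  have key := intervalIntegral.hasSum_intervalIntegral_of_summable_norm (a := 0) (b := 1) (f := e) ?_
  · simpa only [hint] using key
  · refine hsum.norm.of_nonneg_of_le (fun _ => norm_nonneg _) fun n => ?_
    rw [ContinuousMap.norm_le _ (norm_nonneg _)]
    intro t
    simp only [e, ContinuousMap.restrict_apply, ContinuousMap.coe_mk, norm_mul]
    have : (2 * Real.pi * Complex.I * (∑ i, n i * v i : ℤ) * (t : ℝ) : ℂ) =
      ((2 * Real.pi * (∑ i, n i * v i : ℤ) * (t : ℝ) : ℝ) : ℂ) * Complex.I := by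
      push_cast; ring
    rw [this, Complex.norm_exp_ofReal_mul_I, mul_one]

lemma exists_decay {d : ℕ} {f : (Fin d → ℝ) → ℝ} (hf : ContDiff ℝ (⊤ : ℕ∞) f)
    (hsupp : HasCompactSupport f) (A : ℕ) :
    ∃ C : ℝ, 0 ≤ C ∧ ∀ N : ℝ, 0 < N → ∀ n : Fin d → ℤ,
      ‖n‖ ^ A * ‖∫ y, negChar n y * (f (N • y) : ℂ)‖ ≤ C * N ^ A * (N ^ d)⁻¹ := by
  let φ : EuclideanSpace ℝ (Fin d) → ℂ := fun y => (f (WithLp.ofLp y) : ℂ)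
  have hφ : ContDiff ℝ (⊤ : ℕ∞) φ :=
    Complex.ofRealCLM.contDiff.comp (hf.comp (PiLp.contDiff_ofLp (p := 2)))
  have hφs : HasCompactSupport φ := by
    have h1 : HasCompactSupport fun y => (f y : ℂ) := hsupp.comp_left (g := ((↑) : ℝ → ℂ)) Complex.ofReal_zero
    exact h1.comp_homeomorph (PiLp.homeomorph 2 fun _ : Fin d => ℝ)
  let Φ := hφs.toSchwartzMap hφ
  obtain ⟨C, hC⟩ := (FourierTransform.fourier Φ).decay A 0
  refine ⟨C, hC.1.le, fun N hN n => ?_⟩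
  let ξ : EuclideanSpace ℝ (Fin d) := WithLp.toLp 2 fun i => (n i : ℝ) / N
  have hint : ∫ y, negChar n y * (f (N • y) : ℂ) =
      ((N ^ d)⁻¹ : ℝ) • FourierTransform.fourier Φ ξ := by
    have h1 : ∀ y : Fin d → ℝ, negChar n y * (f (N • y) : ℂ) =
        (fun z => negChar n (N⁻¹ • z) * (f z : ℂ)) (N • y) := fun y => by
      simp [smul_smul, inv_mul_cancel₀ hN.ne']
    refine (integral_congr_ae (Filter.Eventually.of_forall h1)).trans
      ((Measure.integral_comp_smul_of_nonneg volume (fun z => negChar n (N⁻¹ • z) * (f z : ℂ)) N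
        (hR := hN.le)).trans ?_)
    simp only [Module.finrank_fintype_fun_eq_card, Fintype.card_fin]
    congr 1
    rw [SchwartzMap.fourier_coe, Real.fourier_eq',
      ← (PiLp.volume_preserving_toLp (Fin d)).integral_comp
        (MeasurableEquiv.toLp 2 (Fin d → ℝ)).measurableEmbedding]
    refine integral_congr_ae (Filter.Eventually.of_forall fun y => ?_)
    simp only [smul_eq_mul, negChar]
    congr 2
    simp only [ξ, EuclideanSpace.inner_eq_star_dotProduct, dotProduct]
    push_cast
    simp only [Finset.mul_sum, Finset.sum_mul, ← Finset.sum_neg_distrib]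
    refine Finset.sum_congr rfl fun i _ => ?_
    simp
    ring
  have hn : ‖n‖ ≤ N * ‖ξ‖ := by
    rw [pi_norm_le_iff_of_nonneg (by positivity)]
    intro i
    have := PiLp.norm_apply_le ξ i
    have h2 : ‖ξ i‖ = ‖n i‖ / N := by
      simp [ξ, abs_of_pos hN, Int.norm_eq_abs]
    rw [h2, div_le_iff₀ hN] at this
    linarith
  have hdec := hC.2 ξ
  rw [norm_iteratedFDeriv_zero] at hdec
  rw [hint, norm_smul, Real.norm_of_nonneg (by positivity)]
  calc ‖n‖ ^ A * ((N ^ d)⁻¹ * ‖FourierTransform.fourier Φ ξ‖)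
      ≤ (N * ‖ξ‖) ^ A * ((N ^ d)⁻¹ * ‖FourierTransform.fourier Φ ξ‖) := by gcongr
    _ = (‖ξ‖ ^ A * ‖FourierTransform.fourier Φ ξ‖) * N ^ A * (N ^ d)⁻¹ := by
        rw [mul_pow]; ring
    _ ≤ C * N ^ A * (N ^ d)⁻¹ := by gcongr

lemma summable_norm_int_pi (d : ℕ) :
    Summable fun n : Fin d → ℤ => (‖n‖ ^ (d + 1))⁻¹ := by
  let b := Pi.basisFun ℝ (Fin d)
  let L := Submodule.span ℤ (Set.range b)
  let bz : Module.Basis (Fin d) ℤ L := b.restrictScalars ℤ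
  have hr : Module.finrank ℤ L = d := by
    rw [Module.finrank_eq_card_basis bz, Fintype.card_fin]
  have hs := ZLattice.summable_norm_zpow L (-(d + 1 : ℤ)) (by rw [hr]; omega)
  have := (bz.equivFun.symm.toEquiv.summable_iff).2 hs
  refine this.congr fun n => ?_
  have hn : ‖bz.equivFun.symm n‖ = ‖n‖ := by
    have : ((bz.equivFun.symm n : L) : Fin d → ℝ) = fun i => (n i : ℝ) := by
      rw [Module.Basis.equivFun_symm_apply]
      funext i
      have hb : ∀ j, (bz j : Fin d → ℝ) = Pi.single j 1 := fun j => by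
        simp only [bz]
        rw [Module.Basis.restrictScalars_apply, Pi.basisFun_apply]
      simp [hb, Pi.single_apply]
    rw [Submodule.coe_norm, this]
    have hz : ∀ z : ℤ, ‖(z : ℝ)‖₊ = ‖z‖₊ := fun z => NNReal.eq (Int.norm_cast_real z)
    simp [Pi.norm_def, hz]
  simp only [Function.comp, LinearEquiv.coe_toEquiv, hn]
  rw [zpow_neg]
  norm_cast

open Classical in
lemma exists_tsum_le {d : ℕ} {f : (Fin d → ℝ) → ℝ} (hf : ContDiff ℝ (⊤ : ℕ∞) f)
    (hsupp : HasCompactSupport f) {δ : ℝ} (hδ : 0 < δ) :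
    ∃ C : ℝ, 0 ≤ C ∧ ∀ N : ℝ, 1 ≤ N → ∀ M : ℕ, N ^ (1 + δ) ≤ M → ∀ p : (Fin d → ℤ) → Prop,
      ∑' n, (if n ≠ 0 ∧ p n then ‖∫ y, negChar n y * (f (N • y) : ℂ)‖ else 0) ≤
        C * (N ^ d)⁻¹ * ((((Finset.Icc (fun _ => -(M : ℤ)) (fun _ => (M : ℤ))).filter
          fun n : Fin d → ℤ => n ≠ 0 ∧ p n).card : ℝ) + N⁻¹) := by
  obtain ⟨B, hB⟩ := exists_nat_ge ((d + 2) / δ)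
  have hB' : (d + 2 : ℝ) ≤ δ * B := by rw [div_le_iff₀ hδ] at hB; linarith
  obtain ⟨C₀, hC₀, h₀⟩ := exists_decay hf hsupp 0
  obtain ⟨C₁, hC₁, h₁⟩ := exists_decay hf hsupp (B + (d + 1))
  set T := ∑' n : Fin d → ℤ, (‖n‖ ^ (d + 1))⁻¹ with hT
  have hT0 : 0 ≤ T := tsum_nonneg fun _ => by positivity
  refine ⟨C₀ + C₁ * T, by positivity, fun N hN M hM p => ?_⟩
  have hN0 : 0 < N := by linarith
  set S := (Finset.Icc (fun _ => -(M : ℤ)) (fun _ => (M : ℤ))).filter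
          fun n : Fin d → ℤ => n ≠ 0 ∧ p n with hS
  have hpt : ∀ n : Fin d → ℤ,
      (if n ≠ 0 ∧ p n then ‖∫ y, negChar n y * (f (N • y) : ℂ)‖ else 0) ≤
      (if n ∈ S then C₀ * (N ^ d)⁻¹ else 0) +
        C₁ * (N ^ d)⁻¹ * N⁻¹ * (‖n‖ ^ (d + 1))⁻¹ := by
    intro n
    by_cases hn : n ≠ 0 ∧ p n
    · rw [if_pos hn]
      by_cases hnS : n ∈ S
      · rw [if_pos hnS]
        have := h₀ N hN0 n
        simp only [pow_zero, one_mul, mul_one] at this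
        have h2 : 0 ≤ C₁ * (N ^ d)⁻¹ * N⁻¹ * (‖n‖ ^ (d + 1))⁻¹ := by positivity
        linarith
      · rw [if_neg hnS, zero_add]
        have hbig : (M : ℝ) < ‖n‖ := by
          by_contra hle
          push Not at hle
          apply hnS
          rw [hS, Finset.mem_filter, Finset.mem_Icc]
          have hi : ∀ i, |n i| ≤ (M : ℤ) := fun i => by
            have := (norm_le_pi_norm n i).trans hle
            rw [Int.norm_eq_abs] at this
            exact_mod_cast this
          exact ⟨⟨fun i => (abs_le.1 (hi i)).1, fun i => (abs_le.1 (hi i)).2⟩, hn⟩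
        have hbig' : N ^ (1 + δ) ≤ ‖n‖ := hM.trans hbig.le
        have hn0 : 0 < ‖n‖ := lt_of_lt_of_le (by positivity) hbig'
        have hpow : N ^ (B + (d + 1)) * N ≤ ‖n‖ ^ B := by
          calc N ^ (B + (d + 1)) * N = N ^ ((B : ℝ) + (d + 2)) := by
                rw [← pow_succ, ← Real.rpow_natCast]
                push_cast
                ring_nf
            _ ≤ N ^ ((1 + δ) * B) :=
                Real.rpow_le_rpow_of_exponent_le hN (by nlinarith)
            _ = (N ^ (1 + δ)) ^ B := by rw [Real.rpow_mul hN0.le, Real.rpow_natCast]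
            _ ≤ ‖n‖ ^ B := by gcongr
        have h2 := h₁ N hN0 n
        set J := ‖∫ y, negChar n y * (f (N • y) : ℂ)‖
        rw [mul_assoc, ← mul_inv, ← div_eq_mul_inv, le_div_iff₀ (by positivity)]
        have hJ : 0 ≤ J := norm_nonneg _
        have hNB : 0 < N ^ (B + (d + 1)) := by positivity
        refine le_of_mul_le_mul_left ?_ hNB
        calc N ^ (B + (d + 1)) * (J * (N * ‖n‖ ^ (d + 1)))
            = (N ^ (B + (d + 1)) * N) * ‖n‖ ^ (d + 1) * J := by ring
          _ ≤ ‖n‖ ^ B * ‖n‖ ^ (d + 1) * J := by gcongr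
          _ = ‖n‖ ^ (B + (d + 1)) * J := by rw [pow_add _ B]
          _ ≤ _ := h2
          _ = _ := by ring
    · rw [if_neg hn]
      have : 0 ≤ (if n ∈ S then C₀ * (N ^ d)⁻¹ else 0) := by split_ifs <;> positivity
      have h2 : 0 ≤ C₁ * (N ^ d)⁻¹ * N⁻¹ * (‖n‖ ^ (d + 1))⁻¹ := by positivity
      linarith
  have hsm1 : HasSum (fun n => if n ∈ S then C₀ * (N ^ d)⁻¹ else 0) (S.card * (C₀ * (N ^ d)⁻¹)) := by
    have := hasSum_sum_of_ne_finset_zero (s := S) (L := SummationFilter.unconditional _)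
      (f := fun n => if n ∈ S then C₀ * (N ^ d)⁻¹ else 0) (fun n hn => if_neg hn)
    rwa [Finset.sum_ite_mem, Finset.inter_self, Finset.sum_const, nsmul_eq_mul] at this
  have hsm2 := (summable_norm_int_pi d).hasSum.mul_left (C₁ * (N ^ d)⁻¹ * N⁻¹)
  have hsm := hsm1.add hsm2
  have hle := Summable.tsum_le_tsum hpt
    (Summable.of_nonneg_of_le (fun n => by split_ifs <;> positivity) hpt hsm.summable) hsm.summable
  rw [hsm.tsum_eq, ← hT] at hle
  refine hle.trans ?_
  have hx : 0 ≤ C₁ * T * (N ^ d)⁻¹ * S.card := by positivity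
  have hy : 0 ≤ C₀ * (N ^ d)⁻¹ * N⁻¹ := by positivity
  nlinarith

open Classical in
lemma exists_continuous_and_abs_integral_sub_le {d : ℕ} {f : (Fin d → ℝ) → ℝ} (hf : ContDiff ℝ (⊤ : ℕ∞) f)
    (hsupp : HasCompactSupport f) :
    ∃ N₀ : ℝ, 0 < N₀ ∧ ∀ N : ℝ, N₀ ≤ N → ∀ v : Fin d → ℤ,
      (Continuous fun t : ℝ => ∑' m : Fin d → ℤ, f fun i => N * ((m i : ℝ) + t * v i)) ∧
      |(∫ t in (0 : ℝ)..1, ∑' m : Fin d → ℤ, f fun i => N * ((m i : ℝ) + t * v i)) -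
          (N ^ d)⁻¹ * ∫ y, f y| ≤
        ∑' n, (if n ≠ 0 ∧ ∑ i, n i * v i = 0 then
          ‖∫ y, negChar n y * (f (N • y) : ℂ)‖ else 0) := by
  obtain ⟨R, hR0, hR⟩ := hsupp.isCompact.isBounded.exists_pos_norm_le
  refine ⟨2 * R + 1, by positivity, fun N hN v => ?_⟩
  have hN0 : 0 < N := by linarith
  let g : (Fin d → ℝ) → ℂ := fun y => (f (N • y) : ℂ)
  have hg : Continuous g := by
    have := hf.continuous
    fun_prop
  have hgs : ∀ y, g y ≠ 0 → ∀ i, |y i| < 1 / 2 := by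
    intro y hy i
    have h1 : f (N • y) ≠ 0 := by simpa [g] using hy
    have h2 := (norm_le_pi_norm _ i).trans (hR _ (subset_tsupport _ h1))
    simp only [Pi.smul_apply, smul_eq_mul, norm_mul, Real.norm_eq_abs, abs_of_pos hN0] at h2
    by_contra h3
    push Not at h3
    nlinarith
  have hcomplex : ∀ t : ℝ, ∑' m : Fin d → ℤ, g (fun i => (m i : ℝ) + t * v i) =
      ((∑' m : Fin d → ℤ, f fun i => N * ((m i : ℝ) + t * v i) : ℝ) : ℂ) := fun t => by
    rw [Complex.ofReal_tsum]
    rfl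
  have hcont := (continuous_tsum_shift hg hgs).comp
    (show Continuous fun t : ℝ => fun i => t * (v i : ℝ) by fun_prop)
  refine ⟨(Complex.continuous_re.comp hcont).congr fun t => ?_, ?_⟩
  · simp only [Function.comp, hcomplex, Complex.ofReal_re]
  obtain ⟨C, hC, hdec⟩ := exists_decay hf hsupp (d + 1)
  obtain ⟨C', hC', hdec'⟩ := exists_decay hf hsupp 0
  have hsum : Summable fun n : Fin d → ℤ => ‖∫ y, negChar n y * g y‖ := by
    have h1 := ((summable_norm_int_pi d).mul_left (C * N ^ (d + 1) * (N ^ d)⁻¹)).add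
      (hasSum_ite_eq (0 : Fin d → ℤ) (C' * (N ^ d)⁻¹)).summable
    refine Summable.of_nonneg_of_le (fun _ => norm_nonneg _) (fun n => ?_) h1
    by_cases hn : n = 0
    · have := hdec' N hN0 n
      simp only [pow_zero, one_mul, mul_one] at this
      rw [if_pos hn]
      have h2 : 0 ≤ C * N ^ (d + 1) * (N ^ d)⁻¹ * (‖n‖ ^ (d + 1))⁻¹ := by positivity
      exact this.trans (by linarith)
    · have := hdec N hN0 n
      rw [if_neg hn, add_zero, ← div_eq_mul_inv, le_div_iff₀ (by positivity), mul_comm]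
      exact this
  have key := hasSum_integral_periodization hg hgs hsum.of_norm v
  have hreal : (∫ t in (0 : ℝ)..1, ∑' m : Fin d → ℤ, g fun i => (m i : ℝ) + t * v i) =
      ((∫ t in (0 : ℝ)..1, ∑' m : Fin d → ℤ, f fun i => N * ((m i : ℝ) + t * v i) : ℝ) : ℂ) := by
    rw [← intervalIntegral.integral_ofReal]
    simp only [hcomplex]
  rw [hreal] at key
  have hzero : ∫ y, negChar 0 y * g y = (((N ^ d)⁻¹ * ∫ y, f y : ℝ) : ℂ) := by
    have h1 : ∀ y, negChar 0 y * g y = ((f (N • y) : ℝ) : ℂ) := fun y => by simp [negChar, g]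
    simp_rw [h1]
    rw [integral_complex_ofReal, Measure.integral_comp_smul_of_nonneg _ _ _ (hR := hN0.le)]
    simp
  have key2 := key.sub (hasSum_ite_eq (0 : Fin d → ℤ) (∫ y, negChar 0 y * g y))
  rw [hzero, ← Complex.ofReal_sub] at key2
  have hnorm : ∀ n : Fin d → ℤ, ‖(if ∑ i, n i * v i = 0 then ∫ y, negChar n y * g y else 0) -
      (if n = 0 then (((N ^ d)⁻¹ * ∫ y, f y : ℝ) : ℂ) else 0)‖ =
      if n ≠ 0 ∧ ∑ i, n i * v i = 0 then ‖∫ y, negChar n y * (f (N • y) : ℂ)‖ else 0 := by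
    intro n
    by_cases hn : n = 0
    · subst hn
      simp [← hzero]
    · by_cases h : ∑ i, n i * v i = 0 <;> simp [hn, h, g]
  have hsum2 : Summable fun n : Fin d → ℤ =>
      if n ≠ 0 ∧ ∑ i, n i * v i = 0 then ‖∫ y, negChar n y * (f (N • y) : ℂ)‖ else 0 :=
    Summable.of_nonneg_of_le (fun n => by split_ifs <;> positivity)
      (fun n => by split_ifs <;> [exact le_rfl; exact norm_nonneg _]) hsum
  have := key2.norm_le_of_bounded hsum2.hasSum fun n => (hnorm n).le
  rwa [Complex.norm_real, Real.norm_eq_abs] at this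

/-- `(x, w)` is a solution of `∑ w i * a (x i) = S`, `∑ w i = s` with `x` strictly decreasing in
`[1, N]`, starting at `p`, and `|w i| ≤ M`, where `w` does not vanish off the index `0`. -/
structure IsSol (a : ℕ → ℕ) (N M : ℕ) (j p : ℕ) (S s : ℤ)
    (z : (Fin (j + 1) → ℕ) × (Fin (j + 1) → ℤ)) : Prop where
  head : z.1 0 = p
  anti : StrictAnti z.1
  mem : ∀ i, z.1 i ∈ Finset.Icc 1 N
  bound : ∀ i, |z.2 i| ≤ M
  sum_mul : ∑ i, z.2 i * (a (z.1 i) : ℤ) = S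
  sum : ∑ i, z.2 i = s
  ne_zero : ∃ i : Fin j, z.2 i.succ ≠ 0

lemma card_mul_le_of_fiber {α β : Type*} [DecidableEq β] {A : Finset α} {t : Finset β} (f : α → β)
    (hf : ∀ z ∈ A, f z ∈ t) {Q P : ℕ} (hQ : 0 < Q)
    (h : ∀ b ∈ t, Q * (A.filter fun z => f z = b).card ≤ P) : Q * A.card ≤ P * t.card := by
  have := Finset.card_le_mul_card_image_of_maps_to hf (P / Q) fun b hb =>
    (Nat.le_div_iff_mul_le hQ).2 (by rw [mul_comm]; exact h b hb)
  calc Q * A.card ≤ Q * (P / Q * t.card) := Nat.mul_le_mul_left _ this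
    _ = (Q * (P / Q)) * t.card := by ring
    _ ≤ P * t.card := Nat.mul_le_mul_right _ (Nat.mul_div_le P Q)

lemma IsSol.tail {a : ℕ → ℕ} {N M j p : ℕ} {S s : ℤ}
    {z : (Fin (j + 2) → ℕ) × (Fin (j + 2) → ℤ)} (hz : IsSol a N M (j + 1) p S s z)
    (hne : ∃ i : Fin j, z.2 i.succ.succ ≠ 0) :
    IsSol a N M j (z.1 (Fin.succ 0)) (S - z.2 0 * a p) (s - z.2 0)
      (fun i => z.1 i.succ, fun i => z.2 i.succ) where
  head := rfl
  anti := hz.anti.comp_strictMono Fin.strictMono_succ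
  mem i := hz.mem _
  bound i := hz.bound _
  sum_mul := by
    have := hz.sum_mul
    rw [Fin.sum_univ_succ, hz.head] at this
    simp only
    linarith
  sum := by
    have := hz.sum
    rw [Fin.sum_univ_succ] at this
    simp only
    linarith
  ne_zero := hne

lemma IsSol.lt {a : ℕ → ℕ} {N M j p : ℕ} {S s : ℤ}
    {z : (Fin (j + 2) → ℕ) × (Fin (j + 2) → ℤ)} (hz : IsSol a N M (j + 1) p S s z) :
    z.1 (Fin.succ 0) < p := by
  rw [← hz.head]
  exact hz.anti (Fin.succ_pos 0)

lemma IsSol.abs_lt_of_far {a : ℕ → ℕ} (ha : StrictMono a) {N M K L j p : ℕ} {S s : ℤ}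
    (hgap : ∀ x p, x + L ≤ p → 2 * K * M * a x < a p) (hj : j + 1 ≤ K)
    {z : (Fin (j + 2) → ℕ) × (Fin (j + 2) → ℤ)} (hz : IsSol a N M (j + 1) p S s z)
    (hfar : z.1 (Fin.succ 0) + L ≤ p) : 2 * |S - z.2 0 * a p| < a p := by
  have h1 : S - z.2 0 * a p = ∑ i : Fin (j + 1), z.2 i.succ * (a (z.1 i.succ) : ℤ) := by
    have := hz.sum_mul
    rw [Fin.sum_univ_succ, hz.head] at this
    linarith
  have h2 : |∑ i : Fin (j + 1), z.2 i.succ * (a (z.1 i.succ) : ℤ)| ≤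
      K * (M * a (z.1 (Fin.succ 0))) := by
    calc _ ≤ ∑ i : Fin (j + 1), |z.2 i.succ * (a (z.1 i.succ) : ℤ)| :=
          Finset.abs_sum_le_sum_abs _ _
      _ ≤ ∑ _i : Fin (j + 1), ((M : ℤ) * a (z.1 (Fin.succ 0))) := by
          refine Finset.sum_le_sum fun i _ => ?_
          rw [abs_mul, Nat.abs_cast]
          have h3 : a (z.1 i.succ) ≤ a (z.1 (Fin.succ 0)) :=
            ha.monotone (hz.anti.antitone (Fin.succ_le_succ_iff.2 (Fin.zero_le i)))
          have h4 := hz.bound i.succ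
          gcongr
      _ = ((j + 1 : ℕ) : ℤ) * (M * a (z.1 (Fin.succ 0))) := by simp
      _ ≤ _ := by gcongr
  have h3 : (2 * K * M * a (z.1 (Fin.succ 0)) : ℤ) < a p := by exact_mod_cast hgap _ _ hfar
  rw [h1]
  linarith

lemma eq_of_abs_sub_mul_lt {S u v b : ℤ} (hu : 2 * |S - u * b| < b) (hv : 2 * |S - v * b| < b) :
    u = v := by
  have hu' := abs_lt.1 (show |S - u * b| < b by linarith [abs_nonneg (S - u * b)])
  have h1 : |(u - v) * b| < b := by
    have : (u - v) * b = (S - v * b) - (S - u * b) := by ring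
    rw [this]
    have := abs_sub (S - v * b) (S - u * b)
    linarith
  have hb : 0 < b := by linarith [abs_nonneg ((u - v) * b)]
  rw [abs_mul, abs_of_pos hb] at h1
  have h2 : |u - v| < 1 := by
    by_contra h
    push Not at h
    nlinarith
  have := Int.abs_lt_one_iff.1 h2
  linarith

lemma prod_ext_of_succ_succ {j : ℕ} {z z' : (Fin (j + 2) → ℕ) × (Fin (j + 2) → ℤ)}
    (h0 : z.1 0 = z'.1 0) (h1 : z.1 (Fin.succ 0) = z'.1 (Fin.succ 0))
    (h2 : ∀ i : Fin j, z.1 i.succ.succ = z'.1 i.succ.succ)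
    (k0 : z.2 0 = z'.2 0) (k1 : z.2 (Fin.succ 0) = z'.2 (Fin.succ 0))
    (k2 : ∀ i : Fin j, z.2 i.succ.succ = z'.2 i.succ.succ) : z = z' := by
  refine Prod.ext (funext fun i => ?_) (funext fun i => ?_)
  · exact Fin.cases h0 (fun i => Fin.cases h1 h2 i) i
  · exact Fin.cases k0 (fun i => Fin.cases k1 k2 i) i

lemma card_mul_le_of_tail_ne_zero {a : ℕ → ℕ} (ha : StrictMono a) {N M K L Q : ℕ} (hL : 1 ≤ L)
    (hgap : ∀ x p, x + L ≤ p → 2 * K * M * a x < a p) (hQ : 2 * M + 1 ≤ Q) (hN : N ≤ Q)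
    {j P : ℕ} (hj : j + 1 ≤ K)
    (ih : ∀ p S s, ∀ A : Finset ((Fin (j + 1) → ℕ) × (Fin (j + 1) → ℤ)),
      (∀ z ∈ A, IsSol a N M j p S s z) → Q * A.card ≤ P)
    {p : ℕ} {S s : ℤ} {A : Finset ((Fin (j + 2) → ℕ) × (Fin (j + 2) → ℤ))}
    (hA : ∀ z ∈ A, IsSol a N M (j + 1) p S s z)
    (hne : ∀ z ∈ A, ∃ i : Fin j, z.2 i.succ.succ ≠ 0) :
    Q * A.card ≤ P * (2 * L * Q) := by
  classical
  have hQ0 : 0 < Q := by omega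
  let W := Finset.Icc (-(M : ℤ)) M
  let V := W.filter fun w => 2 * |S - w * a p| < a p
  let t := (W ×ˢ Finset.Ico (p - L) p) ∪ (V ×ˢ Finset.Icc 1 N)
  have ht : t.card ≤ 2 * L * Q := by
    have hW : W.card ≤ Q := by simp only [W, Int.card_Icc]; omega
    have hV : V.card ≤ 1 := Finset.card_le_one.2 fun u hu v hv =>
      eq_of_abs_sub_mul_lt (Finset.mem_filter.1 hu).2 (Finset.mem_filter.1 hv).2
    have hI : (Finset.Ico (p - L) p).card ≤ L := by rw [Nat.card_Ico]; omega
    calc t.card ≤ W.card * (Finset.Ico (p - L) p).card + V.card * (Finset.Icc 1 N).card := by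
          refine (Finset.card_union_le _ _).trans ?_
          rw [Finset.card_product, Finset.card_product]
      _ ≤ Q * L + 1 * Q := by
          have : (Finset.Icc 1 N).card ≤ Q := by simpa using hN
          gcongr
      _ ≤ 2 * L * Q := by nlinarith
  refine (card_mul_le_of_fiber (fun z => (z.2 0, z.1 (Fin.succ 0))) (t := t) ?_ hQ0 ?_).trans
    (Nat.mul_le_mul_left P ht)
  · intro z hz
    have h := hA z hz
    have hW : z.2 0 ∈ W := by
      have := abs_le.1 (h.bound 0)
      simpa [W] using this
    simp only [t, Finset.mem_union, Finset.mem_product]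
    by_cases hfar : z.1 (Fin.succ 0) + L ≤ p
    · exact Or.inr ⟨Finset.mem_filter.2 ⟨hW, h.abs_lt_of_far ha hgap hj hfar⟩, h.mem _⟩
    · refine Or.inl ⟨hW, Finset.mem_Ico.2 ⟨by omega, h.lt⟩⟩
  · rintro ⟨w, x⟩ _
    rw [← Finset.card_image_of_injOn (f := fun z : (Fin (j + 2) → ℕ) × (Fin (j + 2) → ℤ) =>
      ((fun i : Fin (j + 1) => z.1 i.succ), (fun i : Fin (j + 1) => z.2 i.succ)))]
    · apply ih x (S - w * a p) (s - w)
      intro y hy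
      obtain ⟨z, hz, rfl⟩ := Finset.mem_image.1 hy
      obtain ⟨hzA, hzb⟩ := Finset.mem_filter.1 hz
      obtain ⟨h1, h2⟩ := Prod.mk.inj hzb
      have := (hA z hzA).tail (hne z hzA)
      rwa [h1, h2] at this
    · intro z hz z' hz' heq
      obtain ⟨hzA, hzb⟩ := Finset.mem_filter.1 hz
      obtain ⟨hzA', hzb'⟩ := Finset.mem_filter.1 hz'
      obtain ⟨h1, h2⟩ := Prod.mk.inj hzb
      obtain ⟨h1', h2'⟩ := Prod.mk.inj hzb'
      obtain ⟨e1, e2⟩ := Prod.mk.inj heq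
      exact prod_ext_of_succ_succ ((hA z hzA).head.trans (hA z' hzA').head.symm)
        (h2.trans h2'.symm) (fun i => congrFun e1 i.succ) (h1.trans h1'.symm)
        (congrFun e2 0) (fun i => congrFun e2 i.succ)

lemma card_le_of_tail_eq_zero {a : ℕ → ℕ} (ha : StrictMono a) {N M K L : ℕ} (hL : 1 ≤ L)
    (hgap : ∀ x p, x + L ≤ p → 2 * K * M * a x < a p) {j : ℕ} (hj : j + 1 ≤ K)
    {p : ℕ} {S s : ℤ} {A : Finset ((Fin (j + 2) → ℕ) × (Fin (j + 2) → ℤ))}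
    (hA : ∀ z ∈ A, IsSol a N M (j + 1) p S s z)
    (hzero : ∀ z ∈ A, ∀ i : Fin j, z.2 i.succ.succ = 0) :
    A.card ≤ 2 * L * N ^ j := by
  classical
  have hsum : ∀ z ∈ A, z.2 0 * a p + z.2 (Fin.succ 0) * a (z.1 (Fin.succ 0)) = S := by
    intro z hz
    have := (hA z hz).sum_mul
    rw [Fin.sum_univ_succ, Fin.sum_univ_succ, (hA z hz).head] at this
    simpa [hzero z hz] using this
  have hsum' : ∀ z ∈ A, z.2 0 + z.2 (Fin.succ 0) = s := by
    intro z hz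
    have := (hA z hz).sum
    rw [Fin.sum_univ_succ, Fin.sum_univ_succ] at this
    simpa [hzero z hz] using this
  have hne : ∀ z ∈ A, z.2 (Fin.succ 0) ≠ 0 := by
    intro z hz h
    obtain ⟨i, hi⟩ := (hA z hz).ne_zero
    exact hi (Fin.cases h (hzero z hz) i)
  have hmaps : ∀ z ∈ A, (fun i : Fin j => z.1 i.succ.succ) ∈
      Fintype.piFinset fun _ : Fin j => Finset.Icc 1 N := fun z hz =>
    Fintype.mem_piFinset.2 fun i => (hA z hz).mem _
  have key := Finset.card_le_mul_card_image_of_maps_to hmaps (2 * L) ?_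
  · simpa using key
  intro b _
  set B := A.filter fun z => (fun i : Fin j => z.1 i.succ.succ) = b with hB
  have hBA : ∀ z ∈ B, z ∈ A := fun z hz => (Finset.mem_filter.1 hz).1
  have hBb : ∀ z ∈ B, ∀ i : Fin j, z.1 i.succ.succ = b i := fun z hz i =>
    congrFun (Finset.mem_filter.1 hz).2 i
  have hext : ∀ z ∈ B, ∀ z' ∈ B, z.1 (Fin.succ 0) = z'.1 (Fin.succ 0) → z.2 0 = z'.2 0 →
      z = z' := by
    intro z hz z' hz' h1 h2
    have e := hsum' z (hBA z hz)
    have e' := hsum' z' (hBA z' hz')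
    exact prod_ext_of_succ_succ ((hA z (hBA z hz)).head.trans (hA z' (hBA z' hz')).head.symm) h1
      (fun i => (hBb z hz i).trans (hBb z' hz' i).symm) h2 (by linarith)
      (fun i => (hzero z (hBA z hz) i).trans (hzero z' (hBA z' hz') i).symm)
  rw [← Finset.card_filter_add_card_filter_not fun z => z.1 (Fin.succ 0) + L ≤ p]
  have hfar : (B.filter fun z => z.1 (Fin.succ 0) + L ≤ p).card ≤ 1 := by
    refine Finset.card_le_one.2 fun z hz z' hz' => ?_
    obtain ⟨hz, hf⟩ := Finset.mem_filter.1 hz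
    obtain ⟨hz', hf'⟩ := Finset.mem_filter.1 hz'
    have h2 : z.2 0 = z'.2 0 := eq_of_abs_sub_mul_lt
      ((hA z (hBA z hz)).abs_lt_of_far ha hgap hj hf)
      ((hA z' (hBA z' hz')).abs_lt_of_far ha hgap hj hf')
    refine hext z hz z' hz' (ha.injective ?_) h2
    have e := hsum z (hBA z hz)
    have e' := hsum z' (hBA z' hz')
    have f := hsum' z (hBA z hz)
    have f' := hsum' z' (hBA z' hz')
    have h3 : z.2 (Fin.succ 0) = z'.2 (Fin.succ 0) := by linarith
    rw [← h2, ← h3] at e'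
    have h4 : z.2 (Fin.succ 0) * (a (z.1 (Fin.succ 0)) : ℤ) =
      z.2 (Fin.succ 0) * (a (z'.1 (Fin.succ 0)) : ℤ) := by linarith
    exact_mod_cast mul_left_cancel₀ (hne z (hBA z hz)) h4
  have hnear : (B.filter fun z => ¬ z.1 (Fin.succ 0) + L ≤ p).card ≤ L := by
    have hI : (Finset.Ico (p - L) p).card ≤ L := by rw [Nat.card_Ico]; omega
    refine (Finset.card_le_card_of_injOn (fun z => z.1 (Fin.succ 0)) ?_ ?_).trans hI
    · intro z hz
      obtain ⟨hz, hf⟩ := Finset.mem_filter.1 hz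
      have := (hA z (hBA z hz)).lt
      simp only [Finset.coe_Ico, Set.mem_Ico]
      omega
    · intro z hz z' hz' h1
      obtain ⟨hz, -⟩ := Finset.mem_filter.1 hz
      obtain ⟨hz', -⟩ := Finset.mem_filter.1 hz'
      simp only at h1
      refine hext z hz z' hz' h1 ?_
      have e := hsum z (hBA z hz)
      have e' := hsum z' (hBA z' hz')
      have f := hsum' z (hBA z hz)
      have f' := hsum' z' (hBA z' hz')
      have hlt : (a (z.1 (Fin.succ 0)) : ℤ) < a p := by exact_mod_cast ha (hA z (hBA z hz)).lt
      rw [← h1] at e'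
      have h3 : (z.2 0 - z'.2 0) * ((a p : ℤ) - a (z.1 (Fin.succ 0))) = 0 := by
        have g : z.2 (Fin.succ 0) = s - z.2 0 := by linarith
        have g' : z'.2 (Fin.succ 0) = s - z'.2 0 := by linarith
        rw [g] at e
        rw [g'] at e'
        linarith
      rcases mul_eq_zero.1 h3 with h | h <;> linarith
  omega

lemma card_mul_le {a : ℕ → ℕ} (ha : StrictMono a) {N M K L Q : ℕ} (hL : 1 ≤ L)
    (hgap : ∀ x p, x + L ≤ p → 2 * K * M * a x < a p) (hQ : 2 * M + 1 ≤ Q) (hN : N ≤ Q) (j : ℕ)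
    (hj : j ≤ K) : ∀ p S s, ∀ A : Finset ((Fin (j + 1) → ℕ) × (Fin (j + 1) → ℤ)),
      (∀ z ∈ A, IsSol a N M j p S s z) → Q * A.card ≤ (4 * L * Q) ^ j := by
  classical
  induction j with
  | zero =>
    intro p S s A hA
    have : A = ∅ := Finset.eq_empty_of_forall_notMem fun z hz => (hA z hz).ne_zero.elim
      fun i _ => i.elim0
    simp [this]
  | succ j ih =>
    intro p S s A hA
    rw [← Finset.card_filter_add_card_filter_not
      fun z : (Fin (j + 2) → ℕ) × (Fin (j + 2) → ℤ) => ∃ i : Fin j, z.2 i.succ.succ ≠ 0]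
    have h1 := card_mul_le_of_tail_ne_zero ha hL hgap hQ hN hj (ih (by omega))
      (A := A.filter fun z => ∃ i : Fin j, z.2 i.succ.succ ≠ 0)
      (fun z hz => hA z (Finset.mem_filter.1 hz).1) (fun z hz => (Finset.mem_filter.1 hz).2)
    have h2 := card_le_of_tail_eq_zero ha hL hgap hj
      (A := A.filter fun z => ¬ ∃ i : Fin j, z.2 i.succ.succ ≠ 0)
      (fun z hz => hA z (Finset.mem_filter.1 hz).1)
      (fun z hz i => by
        have := (Finset.mem_filter.1 hz).2
        push Not at this
        exact this i)
    have h3 : N ^ j ≤ (4 * L * Q) ^ j := Nat.pow_le_pow_left (by nlinarith) j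
    rw [mul_add]
    calc _ ≤ (4 * L * Q) ^ j * (2 * L * Q) + Q * (2 * L * N ^ j) :=
          Nat.add_le_add h1 (Nat.mul_le_mul_left Q h2)
      _ ≤ (4 * L * Q) ^ j * (2 * L * Q) + Q * (2 * L * (4 * L * Q) ^ j) := by gcongr
      _ = (4 * L * Q) ^ (j + 1) := by ring

lemma card_le_of_strictAnti {a : ℕ → ℕ} (ha : StrictMono a) {N M L Q d : ℕ} (hL : 1 ≤ L)
    (hgap : ∀ x p, x + L ≤ p → 2 * d * M * a x < a p) (hQ : 2 * M + 1 ≤ Q) (hN : N ≤ Q)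
    {A : Finset ((Fin (d + 1) → ℕ) × (Fin (d + 1) → ℤ))}
    (hanti : ∀ z ∈ A, StrictAnti z.1) (hmem : ∀ z ∈ A, ∀ i, z.1 i ∈ Finset.Icc 1 N)
    (hbound : ∀ z ∈ A, ∀ i, |z.2 i| ≤ M) (hne : ∀ z ∈ A, z.2 ≠ 0)
    (hsum : ∀ z ∈ A, ∑ i, z.2 i = 0) (hsum' : ∀ z ∈ A, ∑ i, z.2 i * (a (z.1 i) : ℤ) = 0) :
    A.card ≤ (4 * L * Q) ^ d := by
  have hQ0 : 0 < Q := by omega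
  have key := card_mul_le_of_fiber (A := A) (t := Finset.Icc 1 N) (fun z => z.1 0)
    (fun z hz => hmem z hz 0) hQ0 (P := (4 * L * Q) ^ d) fun p _ => ?_
  · refine Nat.le_of_mul_le_mul_left (key.trans ?_) hQ0
    rw [mul_comm]
    gcongr
    simpa using hN
  · refine card_mul_le ha hL hgap hQ hN d le_rfl p 0 0 _ fun z hz => ?_
    obtain ⟨hz, hp⟩ := Finset.mem_filter.1 hz
    refine ⟨hp, hanti z hz, hmem z hz, hbound z hz, hsum' z hz, hsum z hz, ?_⟩
    by_contra h
    push Not at h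
    apply hne z hz
    have h0 : z.2 0 = 0 := by
      have := hsum z hz
      rw [Fin.sum_univ_succ] at this
      simpa [h] using this
    exact funext fun i => Fin.cases h0 h i

lemma card_le_of_forall_injective {a : ℕ → ℕ} (ha : StrictMono a) {N M L Q d : ℕ} (hL : 1 ≤ L)
    (hgap : ∀ x p, x + L ≤ p → 2 * d * M * a x < a p) (hQ : 2 * M + 1 ≤ Q) (hN : N ≤ Q)
    {A : Finset ((Fin (d + 1) → ℕ) × (Fin (d + 1) → ℤ))}
    (hinj : ∀ z ∈ A, Function.Injective z.1) (hmem : ∀ z ∈ A, ∀ i, z.1 i ∈ Finset.Icc 1 N)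
    (hbound : ∀ z ∈ A, ∀ i, |z.2 i| ≤ M) (hne : ∀ z ∈ A, z.2 ≠ 0)
    (hsum : ∀ z ∈ A, ∑ i, z.2 i = 0) (hsum' : ∀ z ∈ A, ∑ i, z.2 i * (a (z.1 i) : ℤ) = 0) :
    A.card ≤ (4 * L * Q) ^ d * (d + 1).factorial := by
  classical
  have key := Finset.card_le_mul_card_image_of_maps_to (s := A)
    (f := fun z => Tuple.sort (OrderDual.toDual ∘ z.1))
    (t := (Finset.univ : Finset (Equiv.Perm (Fin (d + 1)))))
    (fun _ _ => Finset.mem_univ _) ((4 * L * Q) ^ d) fun σ _ => ?_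
  · simpa [Finset.card_univ, Fintype.card_perm] using key
  rw [← Finset.card_image_of_injOn (f := fun z : (Fin (d + 1) → ℕ) × (Fin (d + 1) → ℤ) =>
      (z.1 ∘ σ, z.2 ∘ σ))]
  · refine card_le_of_strictAnti ha hL hgap hQ hN ?_ ?_ ?_ ?_ ?_ ?_ <;> intro y hy <;>
      obtain ⟨z, hz, rfl⟩ := Finset.mem_image.1 hy <;>
      obtain ⟨hz, hσ⟩ := Finset.mem_filter.1 hz
    · have hm : Monotone ((OrderDual.toDual ∘ z.1) ∘ σ) := by
        rw [← hσ]
        exact Tuple.monotone_sort _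
      have hanti : Antitone (z.1 ∘ σ) := fun i j hij => hm hij
      exact hanti.strictAnti_of_injective ((hinj z hz).comp σ.injective)
    · exact fun i => hmem z hz _
    · exact fun i => hbound z hz _
    · intro h
      apply hne z hz
      funext i
      simpa using congrFun h (σ.symm i)
    · rw [← hsum z hz]
      exact Equiv.sum_comp σ z.2
    · rw [← hsum' z hz]
      exact Equiv.sum_comp σ fun i => z.2 i * (a (z.1 i) : ℤ)
  · intro z _ z' _ h
    obtain ⟨h1, h2⟩ := Prod.mk.inj h
    exact Prod.ext (σ.surjective.injective_comp_right h1) (σ.surjective.injective_comp_right h2)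

lemma eq_zero_of_snoc_sub_cons_eq_zero {d : ℕ} {n : Fin d → ℤ}
    (h : ∀ i : Fin (d + 1), (Fin.snoc n 0 : Fin (d + 1) → ℤ) i - (Fin.cons 0 n : Fin (d + 1) → ℤ) i = 0) :
    n = 0 := by
  have key : ∀ m (hm : m < d), n ⟨m, hm⟩ = 0 := by
    intro m
    induction m with
    | zero =>
      intro hm
      obtain ⟨e, rfl⟩ : ∃ e, d = e + 1 := ⟨d - 1, by omega⟩
      have := h (Fin.castSucc 0)
      rw [Fin.snoc_castSucc] at this
      simpa using this
    | succ m ih =>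
      intro hm
      have := h (Fin.castSucc ⟨m + 1, hm⟩)
      rw [Fin.snoc_castSucc] at this
      have e : Fin.castSucc (⟨m + 1, hm⟩ : Fin d) = Fin.succ ⟨m, by omega⟩ := rfl
      rw [e, Fin.cons_succ, ih] at this
      simpa using this
  exact funext fun i => key i.1 i.2

lemma sum_snoc_sub_cons_mul {d : ℕ} (n : Fin d → ℤ) (b : Fin (d + 1) → ℤ) :
    ∑ i, ((Fin.snoc n 0 : Fin (d + 1) → ℤ) i - (Fin.cons 0 n : Fin (d + 1) → ℤ) i) * b i =
      ∑ i : Fin d, n i * (b i.castSucc - b i.succ) := by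
  simp only [sub_mul, mul_sub, Finset.sum_sub_distrib]
  rw [Fin.sum_univ_castSucc, Fin.sum_univ_succ (fun i => (Fin.cons 0 n : Fin (d + 1) → ℤ) i * b i)]
  simp

lemma card_solutions_le {a : ℕ → ℕ} (ha : StrictMono a) {N M L Q d : ℕ} (hL : 1 ≤ L)
    (hgap : ∀ x p, x + L ≤ p → 4 * d * M * a x < a p) (hQ : 4 * M + 1 ≤ Q) (hN : N ≤ Q)
    {A : Finset ((Fin (d + 1) → ℕ) × (Fin d → ℤ))}
    (hinj : ∀ z ∈ A, Function.Injective z.1) (hmem : ∀ z ∈ A, ∀ i, z.1 i ∈ Finset.Icc 1 N)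
    (hbound : ∀ z ∈ A, ∀ i, |z.2 i| ≤ M) (hne : ∀ z ∈ A, z.2 ≠ 0)
    (hsum : ∀ z ∈ A, ∑ i : Fin d, z.2 i * ((a (z.1 i.castSucc) : ℤ) - a (z.1 i.succ)) = 0) :
    A.card ≤ (4 * L * Q) ^ d * (d + 1).factorial := by
  classical
  let φ : (Fin d → ℤ) → Fin (d + 1) → ℤ := fun n i =>
    (Fin.snoc n 0 : Fin (d + 1) → ℤ) i - (Fin.cons 0 n : Fin (d + 1) → ℤ) i
  have hφ : Function.Injective φ := by
    intro n n' h
    refine sub_eq_zero.1 (eq_zero_of_snoc_sub_cons_eq_zero fun i => ?_)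
    have hi := congrFun h i
    have e1 : (Fin.snoc (n - n') 0 : Fin (d + 1) → ℤ) i =
        (Fin.snoc n 0 : Fin (d + 1) → ℤ) i - (Fin.snoc n' 0 : Fin (d + 1) → ℤ) i := by
      refine Fin.lastCases ?_ (fun i => ?_) i <;> simp
    have e2 : (Fin.cons 0 (n - n') : Fin (d + 1) → ℤ) i =
        (Fin.cons 0 n : Fin (d + 1) → ℤ) i - (Fin.cons 0 n' : Fin (d + 1) → ℤ) i := by
      refine Fin.cases ?_ (fun i => ?_) i <;> simp
    simp only [φ] at hi
    rw [e1, e2]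
    linarith
  rw [← Finset.card_image_of_injOn
    (f := fun z : (Fin (d + 1) → ℕ) × (Fin d → ℤ) => (z.1, φ z.2))]
  · refine card_le_of_forall_injective (M := 2 * M) ha hL (fun x p h => ?_) (by omega) hN
      ?_ ?_ ?_ ?_ ?_ ?_
    · have := hgap x p h
      calc _ = 4 * d * M * a x := by ring
        _ < _ := this
    all_goals
      intro y hy
      obtain ⟨z, hz, rfl⟩ := Finset.mem_image.1 hy
    · exact hinj z hz
    · exact hmem z hz
    · intro i
      have e1 : |(Fin.snoc z.2 0 : Fin (d + 1) → ℤ) i| ≤ M := by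
        refine Fin.lastCases ?_ (fun i => ?_) i
        · simp
        · simpa using hbound z hz i
      have e2 : |(Fin.cons 0 z.2 : Fin (d + 1) → ℤ) i| ≤ M := by
        refine Fin.cases ?_ (fun i => ?_) i
        · simp
        · simpa using hbound z hz i
      have := abs_sub ((Fin.snoc z.2 0 : Fin (d + 1) → ℤ) i) ((Fin.cons 0 z.2 : Fin (d + 1) → ℤ) i)
      push_cast
      simp only [φ]
      linarith
    · exact fun h => hne z hz (eq_zero_of_snoc_sub_cons_eq_zero fun i => congrFun h i)
    · have h0 := sum_snoc_sub_cons_mul z.2 fun _ => 1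
      simp only [mul_one, sub_self, mul_zero, Finset.sum_const_zero] at h0
      exact h0
    · exact (sum_snoc_sub_cons_mul z.2 fun i => (a (z.1 i) : ℤ)).trans (hsum z hz)
  · intro z _ z' _ h
    obtain ⟨h1, h2⟩ := Prod.mk.inj h
    exact Prod.ext h1 (hφ h2)

/-- The `k`-tuples of distinct integers in `[1, N]`. -/
abbrev distinctTuples (k N : ℕ) : Finset (Fin k → ℕ) :=
  (Fintype.piFinset fun _ : Fin k => Finset.Icc 1 N).filter Function.Injective

lemma card_distinctTuples_le (k N : ℕ) : (distinctTuples k N).card ≤ N ^ k := by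
  refine (Finset.card_filter_le _ _).trans ?_
  simp

lemma descFactorial_le_card_distinctTuples (k N : ℕ) :
    N.descFactorial k ≤ (distinctTuples k N).card := by
  have h1 : Fintype.card (Fin k ↪ Finset.Icc 1 N) = N.descFactorial k := by
    simp [Fintype.card_embedding_eq]
  rw [← h1, ← Finset.card_univ]
  refine Finset.card_le_card_of_injOn (fun e i => (e i : ℕ)) (fun e _ => ?_) ?_
  · simp only [distinctTuples, Finset.coe_filter, Fintype.mem_piFinset, Set.mem_ofPred_eq]
    exact ⟨fun i => (e i).2, fun i j h => e.injective (Subtype.ext h)⟩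
  · intro e _ e' _ h
    ext i
    exact congrFun h i

lemma abs_card_distinctTuples_div_sub_one_le {d N : ℕ} (hN : d + 1 ≤ N) :
    |((distinctTuples (d + 1) N).card : ℝ) / (N : ℝ) ^ (d + 1) - 1| ≤ (d + 1) * d / N := by
  have hN0 : (0 : ℝ) < N := by exact_mod_cast (by omega : 0 < N)
  have h1 : ((distinctTuples (d + 1) N).card : ℝ) ≤ (N : ℝ) ^ (d + 1) := by
    exact_mod_cast card_distinctTuples_le (d + 1) N
  have h2 : ((N : ℝ) - d) ^ (d + 1) ≤ (distinctTuples (d + 1) N).card := by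
    have h3 := (Nat.pow_sub_le_descFactorial N (d + 1)).trans
      (descFactorial_le_card_distinctTuples (d + 1) N)
    have h4 : ((N + 1 - (d + 1) : ℕ) : ℝ) = N - d := by
      rw [Nat.add_sub_add_right, Nat.cast_sub (by omega)]
    rw [← h4]
    exact_mod_cast h3
  have hdN : (d : ℝ) / N ≤ 1 := by
    rw [div_le_one hN0]
    exact_mod_cast (by omega : d ≤ N)
  have h5 := one_add_mul_le_pow (a := -((d : ℝ) / N)) (by linarith) (d + 1)
  have h6 : (1 + -((d : ℝ) / N)) ^ (d + 1) = ((N : ℝ) - d) ^ (d + 1) / (N : ℝ) ^ (d + 1) := by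
    rw [← div_pow]
    congr 1
    field_simp
    ring
  have h7 : ((N : ℝ) - d) ^ (d + 1) / (N : ℝ) ^ (d + 1) ≤
      ((distinctTuples (d + 1) N).card : ℝ) / (N : ℝ) ^ (d + 1) := by gcongr
  have h8 : ((distinctTuples (d + 1) N).card : ℝ) / (N : ℝ) ^ (d + 1) ≤ 1 :=
    (div_le_one (by positivity)).2 h1
  rw [abs_of_nonpos (by linarith)]
  push_cast at h5
  rw [mul_div_assoc]
  linarith

/-- The tuples `x` of distinct integers in `[1, N]` together with the nonzero frequencies `n` of
size at most `M` satisfying `n · Δ(x) = 0`. -/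
noncomputable def resonances (a : ℕ → ℕ) (d N M : ℕ) : Finset ((Fin (d + 1) → ℕ) × (Fin d → ℤ)) :=
  (distinctTuples (d + 1) N ×ˢ Finset.Icc (fun _ => -(M : ℤ)) (fun _ => (M : ℤ))).filter
    fun z => z.2 ≠ 0 ∧ ∑ i : Fin d, z.2 i * ((a (z.1 i.castSucc) : ℤ) - a (z.1 i.succ)) = 0

lemma card_resonances_le {a : ℕ → ℕ} (ha : StrictMono a) {N M L Q d : ℕ} (hL : 1 ≤ L)
    (hgap : ∀ x p, x + L ≤ p → 4 * d * M * a x < a p) (hQ : 4 * M + 1 ≤ Q) (hN : N ≤ Q) :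
    (resonances a d N M).card ≤ (4 * L * Q) ^ d * (d + 1).factorial := by
  have h : ∀ z ∈ resonances a d N M, (((∀ i, z.1 i ∈ Finset.Icc 1 N) ∧ Function.Injective z.1) ∧
      z.2 ∈ Finset.Icc (fun _ => -(M : ℤ)) (fun _ => (M : ℤ))) ∧
      z.2 ≠ 0 ∧ ∑ i : Fin d, z.2 i * ((a (z.1 i.castSucc) : ℤ) - a (z.1 i.succ)) = 0 := by
    intro z hz
    simpa only [resonances, distinctTuples, Finset.mem_filter, Finset.mem_product,
      Fintype.mem_piFinset] using hz
  refine card_solutions_le ha hL hgap hQ hN (fun z hz => (h z hz).1.1.2)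
    (fun z hz => (h z hz).1.1.1) (fun z hz i => ?_) (fun z hz => (h z hz).2.1)
    (fun z hz => (h z hz).2.2)
  have h1 := Finset.mem_Icc.1 (h z hz).1.2
  exact abs_le.2 ⟨h1.1 i, h1.2 i⟩

lemma exists_abs_integral_Rk_sub_le (a : ℕ → ℕ) {d : ℕ} {f : (Fin d → ℝ) → ℝ}
    (hf : ContDiff ℝ (⊤ : ℕ∞) f) (hsupp : HasCompactSupport f) {δ : ℝ} (hδ : 0 < δ) :
    ∃ C N₀ : ℝ, 0 ≤ C ∧ ∀ N M : ℕ, 1 ≤ N → N₀ ≤ N → (N : ℝ) ^ (1 + δ) ≤ M → d + 1 ≤ N →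
      |(∫ t in (0 : ℝ)..1, Rk a (d + 1) f N t) - ∫ y, f y| ≤
        C * ((N : ℝ)⁻¹ + (resonances a d N M).card * ((N : ℝ) ^ (d + 1))⁻¹) := by
  classical
  obtain ⟨C, hC, hC'⟩ := exists_tsum_le hf hsupp hδ
  obtain ⟨N₀, -, hN₀⟩ := exists_continuous_and_abs_integral_sub_le hf hsupp
  set I := ∫ y, f y
  refine ⟨C + (d + 1) * d * |I|, N₀, by positivity, fun N M hN1 hN0 hM hdN => ?_⟩
  have hNpos : (0 : ℝ) < N := by exact_mod_cast hN1
  set X := distinctTuples (d + 1) N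
  let v : (Fin (d + 1) → ℕ) → Fin d → ℤ := fun x i => (a (x i.castSucc) : ℤ) - a (x i.succ)
  let G : (Fin (d + 1) → ℕ) → ℝ → ℝ := fun x t =>
    ∑' m : Fin d → ℤ, f fun i => (N : ℝ) * ((m i : ℝ) + t * v x i)
  let S : (Fin (d + 1) → ℕ) → Finset (Fin d → ℤ) := fun x =>
    (Finset.Icc (fun _ => -(M : ℤ)) (fun _ => (M : ℤ))).filter
      fun n : Fin d → ℤ => n ≠ 0 ∧ ∑ i, n i * v x i = 0
  have hG : ∀ x, Continuous (G x) ∧ |(∫ t in (0 : ℝ)..1, G x t) - ((N : ℝ) ^ d)⁻¹ * I| ≤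
      C * ((N : ℝ) ^ d)⁻¹ * ((S x).card + (N : ℝ)⁻¹) := fun x =>
    ⟨(hN₀ N hN0 (v x)).1, (hN₀ N hN0 (v x)).2.trans <| by
      refine le_of_eq_of_le ?_ (le_of_le_of_eq
        (hC' N (by exact_mod_cast hN1) M hM fun n => ∑ i, n i * v x i = 0) ?_)
      · congr!
      · simp only [S]
        congr!⟩
  have hR : ∀ t, Rk a (d + 1) f N t = 1 / (N : ℝ) * ∑ x ∈ X, G x t := by
    intro t
    simp only [Rk, G, v, Int.cast_sub, Int.cast_natCast]
    rfl
  have hint : ∫ t in (0 : ℝ)..1, Rk a (d + 1) f N t =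
      1 / (N : ℝ) * ∑ x ∈ X, ∫ t in (0 : ℝ)..1, G x t := by
    simp only [hR]
    rw [intervalIntegral.integral_const_mul, intervalIntegral.integral_finsetSum]
    exact fun x _ => (hG x).1.intervalIntegrable _ _
  have hcard : ∑ x ∈ X, (S x).card = (resonances a d N M).card := by
    rw [resonances, Finset.card_filter, Finset.sum_product]
    exact Finset.sum_congr rfl fun x _ => Finset.card_filter _ _
  have hXle : (X.card : ℝ) ≤ (N : ℝ) ^ (d + 1) := by
    exact_mod_cast card_distinctTuples_le (d + 1) N
  have hsplit : (∫ t in (0 : ℝ)..1, Rk a (d + 1) f N t) - I =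
      1 / (N : ℝ) * ∑ x ∈ X, ((∫ t in (0 : ℝ)..1, G x t) - ((N : ℝ) ^ d)⁻¹ * I) +
        ((X.card : ℝ) / (N : ℝ) ^ (d + 1) - 1) * I := by
    rw [hint, Finset.sum_sub_distrib, Finset.sum_const, nsmul_eq_mul]
    field_simp
    ring
  have h1 : |1 / (N : ℝ) * ∑ x ∈ X, ((∫ t in (0 : ℝ)..1, G x t) - ((N : ℝ) ^ d)⁻¹ * I)| ≤
      C * ((N : ℝ)⁻¹ + (resonances a d N M).card * ((N : ℝ) ^ (d + 1))⁻¹) := by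
    rw [abs_mul, abs_of_nonneg (by positivity)]
    calc 1 / (N : ℝ) * |∑ x ∈ X, ((∫ t in (0 : ℝ)..1, G x t) - ((N : ℝ) ^ d)⁻¹ * I)|
        ≤ 1 / (N : ℝ) * ∑ x ∈ X, C * ((N : ℝ) ^ d)⁻¹ * ((S x).card + (N : ℝ)⁻¹) := by
          gcongr
          exact (Finset.abs_sum_le_sum_abs _ _).trans (Finset.sum_le_sum fun x _ => (hG x).2)
      _ = C * (X.card * ((N : ℝ) ^ (d + 1))⁻¹ * (N : ℝ)⁻¹ +
            (resonances a d N M).card * ((N : ℝ) ^ (d + 1))⁻¹) := by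
          rw [← Finset.mul_sum, Finset.sum_add_distrib, ← hcard, Finset.sum_const, nsmul_eq_mul]
          push_cast
          field_simp
          ring
      _ ≤ _ := by
          gcongr
          rw [← div_eq_mul_inv]
          exact mul_le_of_le_one_left (by positivity) ((div_le_one (by positivity)).2 hXle)
  have h2 : |((X.card : ℝ) / (N : ℝ) ^ (d + 1) - 1) * I| ≤ (d + 1) * d * |I| *
      ((N : ℝ)⁻¹ + (resonances a d N M).card * ((N : ℝ) ^ (d + 1))⁻¹) := by
    rw [abs_mul]
    calc |(X.card : ℝ) / (N : ℝ) ^ (d + 1) - 1| * |I| ≤ (d + 1) * d / N * |I| := by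
          gcongr
          exact abs_card_distinctTuples_div_sub_one_le hdN
      _ = (d + 1) * d * |I| * (N : ℝ)⁻¹ := by ring
      _ ≤ _ := by
          gcongr
          exact le_add_of_nonneg_right (by positivity)
  rw [hsplit, add_mul]
  exact (abs_add_le _ _).trans (add_le_add h1 h2)

lemma pow_mul_le_of_lacunary {c : ℝ} (hc : 0 ≤ c) {a : ℕ → ℕ} (hlac : ∀ n, c * a n < a (n + 1))
    (x j : ℕ) : c ^ j * a x ≤ a (x + j) := by
  induction j with
  | zero => simp
  | succ j ih =>
    have := hlac (x + j)
    rw [pow_succ', mul_assoc, ← add_assoc]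
    exact (mul_le_mul_of_nonneg_left ih hc).trans this.le

lemma strictMono_of_lacunary {c : ℝ} (hc : 1 < c) {a : ℕ → ℕ} (hlac : ∀ n, c * a n < a (n + 1)) :
    StrictMono a := by
  refine strictMono_nat_of_lt_succ fun n => ?_
  have h1 : (a n : ℝ) ≤ c * a n := le_mul_of_one_le_left (by positivity) hc.le
  exact_mod_cast h1.trans_lt (hlac n)

lemma eventually_mul_rpow_lt_rpow_rpow {c : ℝ} (hc : 1 < c) (B s : ℝ) {δ : ℝ} (hδ : 0 < δ) :
    ∀ᶠ N : ℕ in Filter.atTop, B * (N : ℝ) ^ s < c ^ ((N : ℝ) ^ δ) := by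
  have h1 := (isLittleO_rpow_exp_pos_mul_atTop (s / δ) (Real.log_pos hc)).bound
    (c := (|B| + 1)⁻¹) (by positivity)
  have h2 : Filter.Tendsto (fun N : ℕ => (N : ℝ) ^ δ) Filter.atTop Filter.atTop :=
    (tendsto_rpow_atTop hδ).comp tendsto_natCast_atTop_atTop
  filter_upwards [h2.eventually h1, Filter.eventually_ge_atTop 1] with N hN hN1
  have hNpos : (0 : ℝ) < N := by exact_mod_cast hN1
  rw [← Real.rpow_mul hNpos.le, mul_div_cancel₀ _ hδ.ne', Real.norm_of_nonneg (by positivity),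
    Real.norm_of_nonneg (by positivity), ← Real.rpow_def_of_pos (by linarith),
    inv_mul_eq_div, le_div_iff₀ (by positivity)] at hN
  have h3 : 0 < (N : ℝ) ^ s := by positivity
  nlinarith [le_abs_self B]

lemma natCeil_le_two_mul {x : ℝ} (hx : 1 ≤ x) : (⌈x⌉₊ : ℝ) ≤ 2 * x := by
  have := (Nat.ceil_lt_add_one (by linarith : 0 ≤ x)).le
  linarith

/-- A form of the counting lemma: `n · Δ(x) = 0` has `O(N ^ (d + 2dδ))` solutions with
`0 < |n| ≤ ⌈N ^ (1 + δ)⌉`. -/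
lemma eventually_card_resonances_le {c : ℝ} (hc : 1 < c) {a : ℕ → ℕ} (ha : ∀ n, 0 < a n)
    (hlac : ∀ n, c * a n < a (n + 1)) (d : ℕ) {δ : ℝ} (hδ : 0 < δ) :
    ∀ᶠ N : ℕ in Filter.atTop,
      ((resonances a d N ⌈(N : ℝ) ^ (1 + δ)⌉₊).card : ℝ) ≤
        72 ^ d * (d + 1).factorial * (N : ℝ) ^ (d + 2 * d * δ) := by
  filter_upwards [eventually_mul_rpow_lt_rpow_rpow hc (8 * d) (1 + δ) hδ,
    Filter.eventually_ge_atTop 1] with N hN hN1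
  have hN1' : (1 : ℝ) ≤ N := by exact_mod_cast hN1
  have hNpos : (0 : ℝ) < N := by linarith
  have hmono := strictMono_of_lacunary hc hlac
  set M := ⌈(N : ℝ) ^ (1 + δ)⌉₊ with hMdef
  set L := ⌈(N : ℝ) ^ δ⌉₊ with hLdef
  have hδ1 : 1 ≤ (N : ℝ) ^ δ := Real.one_le_rpow hN1' hδ.le
  have hNM : (N : ℝ) ≤ (N : ℝ) ^ (1 + δ) := Real.self_le_rpow_of_one_le hN1' (by linarith)
  have hM1 : (N : ℝ) ^ (1 + δ) ≤ M := Nat.le_ceil _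
  have hM2 : (M : ℝ) ≤ 2 * (N : ℝ) ^ (1 + δ) := natCeil_le_two_mul (hN1'.trans hNM)
  have hL1 : (N : ℝ) ^ δ ≤ L := Nat.le_ceil _
  have hL2 : (L : ℝ) ≤ 2 * (N : ℝ) ^ δ := natCeil_le_two_mul hδ1
  have hL : 1 ≤ L := by exact_mod_cast hδ1.trans hL1
  have hNM' : N ≤ 4 * M + 1 := by
    have : N ≤ M := by exact_mod_cast hNM.trans hM1
    omega
  have hgap : ∀ x p, x + L ≤ p → 4 * d * M * a x < a p := by
    intro x p hxp
    have hax : (0 : ℝ) < a x := by exact_mod_cast ha x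
    have h1 : (4 : ℝ) * d * M < c ^ L := by
      calc (4 : ℝ) * d * M ≤ 4 * d * (2 * (N : ℝ) ^ (1 + δ)) := by gcongr
        _ = 8 * d * (N : ℝ) ^ (1 + δ) := by ring
        _ < c ^ ((N : ℝ) ^ δ) := hN
        _ ≤ c ^ (L : ℝ) := Real.rpow_le_rpow_of_exponent_le hc.le hL1
        _ = c ^ L := Real.rpow_natCast _ _
    have h2 : (4 : ℝ) * d * M * a x < a (x + L) :=
      (mul_lt_mul_of_pos_right h1 hax).trans_le (pow_mul_le_of_lacunary (by linarith) hlac x L)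
    have h3 : 4 * d * M * a x < a (x + L) := by exact_mod_cast h2
    exact h3.trans_le (hmono.monotone hxp)
  have hcount : ((resonances a d N M).card : ℝ) ≤
      (4 * L * (4 * M + 1)) ^ d * (d + 1).factorial := by
    exact_mod_cast card_resonances_le hmono hL hgap le_rfl hNM'
  refine hcount.trans ?_
  have h4 : (4 : ℝ) * L * (4 * M + 1) ≤ 72 * (N : ℝ) ^ (1 + 2 * δ) := by
    calc (4 : ℝ) * L * (4 * M + 1) ≤
          4 * (2 * (N : ℝ) ^ δ) * (4 * (2 * (N : ℝ) ^ (1 + δ)) + (N : ℝ) ^ (1 + δ)) := by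
          gcongr
          exact hN1'.trans hNM
      _ = 72 * ((N : ℝ) ^ δ * (N : ℝ) ^ (1 + δ)) := by ring
      _ = 72 * (N : ℝ) ^ (1 + 2 * δ) := by
          rw [← Real.rpow_add hNpos]
          ring_nf
  calc ((4 : ℝ) * L * (4 * M + 1)) ^ d * (d + 1).factorial
      ≤ (72 * (N : ℝ) ^ (1 + 2 * δ)) ^ d * (d + 1).factorial := by gcongr
    _ = 72 ^ d * (d + 1).factorial * (N : ℝ) ^ (d + 2 * d * δ) := by
        rw [mul_pow, ← Real.rpow_mul_natCast hNpos.le]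
        ring_nf

lemma exists_forall_le_of_eventually {u g : ℕ → ℝ} (hg : ∀ N, 1 ≤ N → 0 < g N) {κ : ℝ}
    (h : ∀ᶠ N in Filter.atTop, u N ≤ κ * g N) : ∃ κ' : ℝ, ∀ N, 1 ≤ N → u N ≤ κ' * g N := by
  obtain ⟨N₁, hN₁⟩ := Filter.eventually_atTop.1 h
  refine ⟨|κ| + ∑ n ∈ Finset.range N₁, |u n / g n|, fun N hN => ?_⟩
  have hgN := hg N hN
  have hs : 0 ≤ ∑ n ∈ Finset.range N₁, |u n / g n| := Finset.sum_nonneg fun _ _ => abs_nonneg _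
  rcases le_or_gt N₁ N with h1 | h1
  · refine (hN₁ N h1).trans (mul_le_mul_of_nonneg_right ?_ hgN.le)
    linarith [le_abs_self κ]
  · rw [← div_le_iff₀ hgN]
    have h2 := Finset.single_le_sum (f := fun n => |u n / g n|) (fun _ _ => abs_nonneg _)
      (Finset.mem_range.2 h1)
    linarith [le_abs_self (u N / g N), abs_nonneg κ]

/-- The mean of the `k`-level correlation sum over `α ∈ [0,1]` is
`∫ f + O_{f,ε}(N^(-1+ε))`. -/
theorem stmt8 (c : ℝ) (hc : 1 < c) (a : ℕ → ℕ) (ha : ∀ n, 0 < a n)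
    (hlac : ∀ n, c * a n < a (n + 1)) (k : ℕ) (hk : 2 ≤ k)
    (f : (Fin (k - 1) → ℝ) → ℝ) (hf : ContDiff ℝ (⊤ : ℕ∞) f) (hsupp : HasCompactSupport f) :
    ∀ ε : ℝ, 0 < ε → ∃ κ : ℝ, ∀ N : ℕ, 1 ≤ N →
      |(∫ α in (0:ℝ)..1, Rk a k f N α) - ∫ y : Fin (k - 1) → ℝ, f y|
        ≤ κ * (N : ℝ) ^ (-1 + ε) := by
  intro ε hε
  obtain ⟨d, rfl⟩ : ∃ d, k = d + 1 := ⟨k - 1, by omega⟩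
  have hd : (0 : ℝ) < d := by exact_mod_cast (by omega : 0 < d)
  obtain ⟨δ, hδ, hδε⟩ : ∃ δ : ℝ, 0 < δ ∧ 2 * d * δ = ε :=
    ⟨ε / (2 * d), by positivity, by field_simp⟩
  obtain ⟨C, N₀, hC, hmain⟩ := exists_abs_integral_Rk_sub_le a (d := d) hf hsupp hδ
  refine exists_forall_le_of_eventually (g := fun N => (N : ℝ) ^ (-1 + ε))
    (κ := C * (1 + 72 ^ d * (d + 1).factorial))
    (fun N hN => Real.rpow_pos_of_pos (by exact_mod_cast hN) _) ?_
  filter_upwards [eventually_card_resonances_le hc ha hlac d hδ,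
    Filter.eventually_ge_atTop (d + 1), Filter.eventually_ge_atTop ⌈N₀⌉₊] with N hcard hdN hN0
  have hN1 : 1 ≤ N := by omega
  have hN1' : (1 : ℝ) ≤ N := by exact_mod_cast hN1
  have hNpos : (0 : ℝ) < N := by linarith
  refine (hmain N _ hN1 (Nat.ceil_le.1 hN0) (Nat.le_ceil _) hdN).trans ?_
  rw [mul_assoc, add_mul, one_mul]
  refine mul_le_mul_of_nonneg_left (add_le_add ?_ ?_) hC
  · rw [← Real.rpow_neg_one]
    exact Real.rpow_le_rpow_of_exponent_le hN1' (by linarith)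
  · rw [hδε] at hcard
    refine (mul_le_mul_of_nonneg_right hcard (by positivity)).trans_eq ?_
    rw [mul_assoc, ← Real.rpow_natCast (N : ℝ), ← Real.rpow_neg hNpos.le, ← Real.rpow_add hNpos]
    congr 2
    push_cast
    ring
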